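/- arXiv:2408.07499 — 4 statements merged into one kernel-verified Lean document; each statement's English description precedes it below -/
import Mathlib

section
/- Let ψ : K → K' be an isomorphism of fields, let f be a nonzero polynomial over K, let M be a splitting field of f over K, and let M' be a splitting field of ψ_* f over K'. Then there exists an isomorphism φ : M → M' extending ψ, and the number of isomorphisms φ : M → M' extending ψ is at most [M : K]. -/
/-- If `M'` is a splitting field of `ψ_* f` over `K'` for a surjective `ψ : K → K'`, then it is a
splitting field of `f` over `K`, acting on `M'` through `ψ`. -/
theorem Polynomial.IsSplittingField.of_map_of_surjective {K K' M' : Type*} [Field K] [Field K']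
    [Field M'] [Algebra K' M'] [Algebra K M'] (ψ : K →+* K') (hψ : Function.Surjective ψ)
    (hcomp : algebraMap K M' = (algebraMap K' M').comp ψ) (f : Polynomial K)
    (hM' : Polynomial.IsSplittingField K' M' (f.map ψ)) :
    Polynomial.IsSplittingField K M' f where
  splits' := by
    have h := hM'.splits'
    rwa [Polynomial.map_map, ← hcomp] at h
  adjoin_rootSet' := by
    have hroots : (f.map ψ).rootSet M' = f.rootSet M' := by
      simp only [Polynomial.rootSet, Polynomial.aroots, Polynomial.map_map, hcomp]
    refine eq_top_iff.2 fun x _ => ?_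
    have hx : x ∈ Algebra.adjoin K' ((f.map ψ).rootSet M') := by
      rw [hM'.adjoin_rootSet']
      trivial
    rw [hroots] at hx
    induction hx using Algebra.adjoin_induction with
    | mem x hx => exact Algebra.subset_adjoin hx
    | algebraMap r =>
      obtain ⟨a, rfl⟩ := hψ r
      rw [← RingHom.comp_apply, ← hcomp]
      exact Subalgebra.algebraMap_mem _ a
    | add x y _ _ hx hy => exact add_mem (hx trivial) (hy trivial)
    | mul x y _ _ hx hy => exact mul_mem (hx trivial) (hy trivial)

/-- Let `ψ : K ≃ K'` be an isomorphism of fields, `f ≠ 0` a polynomial over `K`, `M` a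
splitting field of `f` over `K`, and `M'` a splitting field of `ψ_* f` over `K'`. Then there
exists an isomorphism `φ : M ≃ M'` extending `ψ`, and there are at most `[M : K]` such
isomorphisms. -/
theorem stmt6 {K K' M M' : Type*} [Field K] [Field K'] [Field M] [Field M']
    [Algebra K M] [Algebra K' M'] (ψ : K ≃+* K') (f : Polynomial K) (hf : f ≠ 0)
    (hM : Polynomial.IsSplittingField K M f)
    (hM' : Polynomial.IsSplittingField K' M' (f.map (ψ : K →+* K'))) :
    (∃ φ : M ≃+* M', ∀ a : K, φ (algebraMap K M a) = algebraMap K' M' (ψ a)) ∧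
    Nat.card {φ : M ≃+* M' // ∀ a : K, φ (algebraMap K M a) = algebraMap K' M' (ψ a)} ≤
      Module.finrank K M := by
  let _ : Algebra K M' := ((algebraMap K' M').comp (ψ : K →+* K')).toAlgebra
  have hsplit : Polynomial.IsSplittingField K M' f :=
    .of_map_of_surjective (ψ : K →+* K') ψ.surjective rfl f hM'
  have := Polynomial.IsSplittingField.finiteDimensional M f
  constructor
  · let e : M ≃ₐ[K] M' := (Polynomial.IsSplittingField.algEquiv M f).trans
      (Polynomial.IsSplittingField.algEquiv M' f).symm
    exact ⟨e.toRingEquiv, e.commutes⟩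
  · let toAlgHom (φ : {φ : M ≃+* M' // ∀ a : K, φ (algebraMap K M a) = algebraMap K' M' (ψ a)}) :
        M →ₐ[K] M' := { (φ.1 : M →+* M') with commutes' := φ.2 }
    have hinj : Function.Injective toAlgHom := fun φ₁ φ₂ h =>
      Subtype.ext (RingEquiv.ext fun x => DFunLike.congr_fun h x)
    exact (Nat.card_le_card_of_injective toAlgHom hinj).trans (card_algHom_le_finrank K M M')
end

section
/- Let ψ : K → K' be an isomorphism of fields, let f be a nonzero polynomial over K, let M be a splitting field of f over K, and let M' be a splitting field of ψ_* f over K'. If the extension M' : K' is separable, then the number of isomorphisms φ : M → M' extending ψ is exactly [M : K]. -/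
open Polynomial in
/-- A splitting field of `f.map ψ`, with `ψ` an isomorphism of fields, is a splitting field of `f`
over the source of `ψ`. -/
theorem Polynomial.IsSplittingField.of_map_ringEquiv {K K' L : Type*} [Field K] [Field K']
    [Field L] [Algebra K L] [Algebra K' L] (ψ : K ≃+* K')
    (hψ : ∀ a, algebraMap K L a = algebraMap K' L (ψ a)) (f : K[X])
    (h : IsSplittingField K' L (f.map (ψ : K →+* K'))) : IsSplittingField K L f := by
  have hcomp : (algebraMap K' L).comp (ψ : K →+* K') = algebraMap K L :=
    RingHom.ext fun a => (hψ a).symm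
  refine ⟨?_, ?_⟩
  · simpa only [Polynomial.map_map, hcomp] using h.splits'
  · have hroots : (f.map (ψ : K →+* K')).rootSet L = f.rootSet L := by
      simp only [rootSet, aroots, Polynomial.map_map, hcomp]
    refine eq_top_iff.2 fun x _ => ?_
    have hx : x ∈ Algebra.adjoin K' (f.rootSet L) := by
      rw [← hroots, h.adjoin_rootSet']
      exact Algebra.mem_top
    induction hx using Algebra.adjoin_induction with
    | mem x hx => exact Algebra.subset_adjoin hx
    | algebraMap r =>
      rw [← ψ.apply_symm_apply r, ← hψ]
      exact Subalgebra.algebraMap_mem _ _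
    | add x y _ _ hx hy => exact add_mem (hx trivial) (hy trivial)
    | mul x y _ _ hx hy => exact mul_mem (hx trivial) (hy trivial)

/-- Two splitting fields `M`, `M'` of the same polynomial over `K`, with `M'` separable over `K`,
admit exactly `[M : K]` isomorphisms over `K`. -/
theorem Polynomial.IsSplittingField.natCard_algEquiv {K M M' : Type*} [Field K] [Field M]
    [Field M'] [Algebra K M] [Algebra K M'] (f : Polynomial K)
    [Polynomial.IsSplittingField K M f] [Polynomial.IsSplittingField K M' f]
    [Algebra.IsSeparable K M'] : Nat.card (M ≃ₐ[K] M') = Module.finrank K M := by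
  let e : M ≃ₐ[K] M' := (algEquiv M f).trans (algEquiv M' f).symm
  have : FiniteDimensional K M' := finiteDimensional M' f
  have : Normal K M' := Normal.of_isSplittingField f
  have : IsGalois K M' := ⟨⟩
  rw [e.toLinearEquiv.finrank_eq, ← IsGalois.card_aut_eq_finrank K M']
  exact Nat.card_congr (AlgEquiv.equivCongr e AlgEquiv.refl)


/-- Let `ψ : K ≃ K'` be an isomorphism of fields, `f ≠ 0` a polynomial over `K`, `M` a
splitting field of `f` over `K`, and `M'` a splitting field of `ψ_* f` over `K'`. If the
extension `M' : K'` is separable, then the number of isomorphisms `φ : M ≃ M'` extending `ψ`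
is exactly `[M : K]`. -/
theorem stmt7 {K K' M M' : Type*} [Field K] [Field K'] [Field M] [Field M']
    [Algebra K M] [Algebra K' M'] (ψ : K ≃+* K') (f : Polynomial K) (hf : f ≠ 0)
    (hM : Polynomial.IsSplittingField K M f)
    (hM' : Polynomial.IsSplittingField K' M' (f.map (ψ : K →+* K')))
    (hsep : Algebra.IsSeparable K' M') :
    Nat.card {φ : M ≃+* M' // ∀ a : K, φ (algebraMap K M a) = algebraMap K' M' (ψ a)} =
      Module.finrank K M := by
  let _ : Algebra K M' := ((algebraMap K' M').comp (ψ : K →+* K')).toAlgebra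
  have hψ : ∀ a, algebraMap K M' a = algebraMap K' M' (ψ a) := fun _ => rfl
  have : Polynomial.IsSplittingField K M' f := .of_map_ringEquiv ψ hψ f hM'
  have : Algebra.IsSeparable K M' :=
    Algebra.IsSeparable.of_equiv_equiv ψ.symm (RingEquiv.refl M') <| by
      ext a
      simp [hψ]
  rw [← Polynomial.IsSplittingField.natCard_algEquiv (M := M) (M' := M') f]
  exact Nat.card_congr
    { toFun := fun φ => AlgEquiv.ofRingEquiv (f := φ.1) φ.2
      invFun := fun φ => ⟨φ.toRingEquiv, φ.commutes⟩
      left_inv := fun _ => rfl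
      right_inv := fun _ => rfl }
end

section
/- Let f be a nonzero polynomial over ℚ all of whose complex roots are radical numbers (i.e. f is solvable by radicals). Then the Galois group Gal_ℚ(f) is a solvable group. -/
/-- The field `ℚ^rad` of radical complex numbers: the smallest subfield of `ℂ` closed under
taking `n`-th roots for all `n ≥ 1`. -/
noncomputable def Qrad : Subfield ℂ :=
  sInf {F : Subfield ℂ | ∀ (α : ℂ) (n : ℕ), 1 ≤ n → α ^ n ∈ F → α ∈ F}

/-- Radical numbers are solvable by radicals over `ℚ`. -/
theorem Qrad_le_solvableByRad : Qrad ≤ (solvableByRad ℚ ℂ).toSubfield := by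
  unfold Qrad
  refine sInf_le (Set.mem_ofPred.mpr fun _ _ hn hx ↦ ?_)
  exact solvableByRad.rad_mem (Nat.one_le_iff_ne_zero.mp hn) hx

open Polynomial in
/-- A polynomial all of whose roots in an algebraically closed field are solvable by radicals has
a solvable Galois group. -/
theorem isSolvable_gal_of_forall_root {F E : Type*} [Field F] [Field E] [Algebra F E]
    [IsAlgClosed E] (f : F[X]) (hroots : ∀ z : E, aeval z f = 0 → z ∈ solvableByRad F E) :
    Group.IsSolvable f.Gal := by
  induction f using UniqueFactorizationMonoid.induction_on_prime with
  | h₁ => exact gal_zero_isSolvable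
  | h₂ u hu =>
    obtain ⟨c, -, rfl⟩ := Polynomial.isUnit_iff.mp hu
    exact gal_C_isSolvable c
  | h₃ g p _ hp ih =>
    refine gal_mul_isSolvable ?_ (ih fun z hz ↦ hroots z (by simp [hz]))
    obtain ⟨z, hz⟩ := IsAlgClosed.exists_aeval_eq_zero E p
      (Polynomial.degree_pos_of_irreducible hp.irreducible).ne'
    exact isSolvable_gal_of_irreducible (hroots z (by simp [hz])) hp.irreducible hz

/-- If every complex root of a nonzero polynomial `f` over `ℚ` is radical (i.e. `f` is
solvable by radicals), then the Galois group of `f` over `ℚ` is a solvable group. -/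
theorem stmt16 (f : Polynomial ℚ) (hf : f ≠ 0)
    (hroots : ∀ z : ℂ, Polynomial.aeval z f = 0 → z ∈ Qrad) :
    IsSolvable (f.SplittingField ≃ₐ[ℚ] f.SplittingField) := by
  exact isSolvable_gal_of_forall_root (E := ℂ) f fun z hz ↦
    SetLike.le_def.mp Qrad_le_solvableByRad (hroots z hz)
end

section
/- The polynomial f(t) = t⁵ − 6t + 3 over ℚ is irreducible, has Galois group Gal_ℚ(f) isomorphic to S₅, and is not solvable by radicals: it has a complex root that is not a radical number. -/
open Polynomial

theorem monic_X_pow_five_sub : (X ^ 5 - 6 * X + 3 : ℤ[X]).Monic := by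
  monicity!

theorem natDegree_X_pow_five_sub : (X ^ 5 - 6 * X + 3 : ℚ[X]).natDegree = 5 := by
  compute_degree!

theorem irreducible_X_pow_five_sub : Irreducible (X ^ 5 - 6 * X + 3 : ℚ[X]) := by
  have hdeg : (X ^ 5 - 6 * X + 3 : ℤ[X]).natDegree = 5 := by compute_degree!
  have hmap : (X ^ 5 - 6 * X + 3 : ℤ[X]).map (algebraMap ℤ ℚ) = X ^ 5 - 6 * X + 3 := by simp
  rw [← hmap, ← monic_X_pow_five_sub.irreducible_iff_irreducible_map_fraction_map (K := ℚ)]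
  have hprime : Prime (3 : ℤ) := Int.prime_three
  have hcoeff : ∀ n, (X ^ 5 - 6 * X + 3 : ℤ[X]).coeff n =
      (if n = 5 then 1 else 0) - 6 * (if 1 = n then 1 else 0) + (if n = 0 then 3 else 0) := by
    intro n
    rw [← C_ofNat, ← C_ofNat, coeff_add, coeff_sub, coeff_C_mul, coeff_X_pow, coeff_X, coeff_C]
  refine irreducible_of_eisenstein_criterion (P := Ideal.span {(3 : ℤ)})
    ((Ideal.span_singleton_prime hprime.ne_zero).2 hprime) ?_ ?_ ?_ ?_
    monic_X_pow_five_sub.isPrimitive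
  · rw [monic_X_pow_five_sub.leadingCoeff, Ideal.mem_span_singleton]
    decide
  · intro n hn
    rw [degree_eq_natDegree monic_X_pow_five_sub.ne_zero, hdeg] at hn
    have hn : n < 5 := by exact_mod_cast hn
    rw [Ideal.mem_span_singleton, hcoeff]
    interval_cases n <;> decide
  · rw [degree_eq_natDegree monic_X_pow_five_sub.ne_zero, hdeg]
    norm_num
  · rw [Ideal.span_singleton_pow, Ideal.mem_span_singleton, hcoeff]
    decide

theorem card_rootSet_real_le : Fintype.card ((X ^ 5 - 6 * X + 3 : ℚ[X]).rootSet ℝ) ≤ 3 := by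
  have h₁ := card_rootSet_le_derivative (X ^ 5 - 6 * X + 3 : ℚ[X])
  have h₂ := card_rootSet_le_derivative (derivative (X ^ 5 - 6 * X + 3 : ℚ[X]))
  have hderiv : derivative (derivative (X ^ 5 - 6 * X + 3 : ℚ[X])) = C 20 * X ^ 3 := by
    norm_num
    simp only [map_ofNat]
    ring
  have h₃ : Fintype.card ((C 20 * X ^ 3 : ℚ[X]).rootSet ℝ) = 1 := by
    have : (C 20 * X ^ 3 : ℚ[X]).rootSet ℝ = {0} := rootSet_C_mul_X_pow (by norm_num) (by norm_num)
    simp [this]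
  simp only [hderiv] at h₂
  omega

theorem two_le_card_rootSet_real :
    2 ≤ Fintype.card ((X ^ 5 - 6 * X + 3 : ℚ[X]).rootSet ℝ) := by
  have hne := irreducible_X_pow_five_sub.ne_zero
  have hcont : Continuous fun x : ℝ => x ^ 5 - 6 * x + 3 := by fun_prop
  obtain ⟨x, hx, hfx⟩ := intermediate_value_Icc' (show (0 : ℝ) ≤ 1 by norm_num) hcont.continuousOn
    (show (0 : ℝ) ∈ _ by norm_num)
  obtain ⟨y, hy, hfy⟩ := intermediate_value_Ioc (show (1 : ℝ) ≤ 2 by norm_num) hcont.continuousOn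
    (show (0 : ℝ) ∈ _ by norm_num)
  refine Fintype.one_lt_card_iff.2
    ⟨⟨x, mem_rootSet.2 ⟨hne, by simpa [map_ofNat] using hfx⟩⟩,
      ⟨y, mem_rootSet.2 ⟨hne, by simpa [map_ofNat] using hfy⟩⟩, fun h => ?_⟩
  exact (hx.2.trans_lt hy.1).ne (congrArg Subtype.val h)

theorem card_rootSet_complex : Fintype.card ((X ^ 5 - 6 * X + 3 : ℚ[X]).rootSet ℂ) = 5 :=
  (card_rootSet_eq_natDegree irreducible_X_pow_five_sub.separable (IsAlgClosed.splits _)).trans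
    natDegree_X_pow_five_sub

theorem nonempty_gal_mulEquiv_perm :
    Nonempty ((X ^ 5 - 6 * X + 3 : ℚ[X]).Gal ≃* Equiv.Perm (Fin 5)) := by
  have := Gal.splits_ℚ_ℂ (p := X ^ 5 - 6 * X + 3)
  have hbij := Gal.galActionHom_bijective_of_prime_degree' irreducible_X_pow_five_sub
    (by rw [natDegree_X_pow_five_sub]; exact Nat.prime_five)
    (by have := card_rootSet_real_le; rw [card_rootSet_complex]; omega)
    (by have := two_le_card_rootSet_real; rw [card_rootSet_complex]; omega)
  exact ⟨(MulEquiv.ofBijective _ hbij).trans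
    (Fintype.equivFinOfCardEq card_rootSet_complex).permCongrHom⟩

theorem mem_solvableByRad_of_mem_Qrad {z : ℂ} (hz : z ∈ Qrad) : z ∈ solvableByRad ℚ ℂ := by
  have hle : Qrad ≤ (solvableByRad ℚ ℂ).toSubfield :=
    sInf_le fun _ _ hn hα => solvableByRad.rad_mem (Nat.one_le_iff_ne_zero.1 hn) hα
  exact hle hz

/-- The polynomial `t⁵ − 6t + 3` over `ℚ` is irreducible, has Galois group isomorphic to
`S₅`, and is not solvable by radicals: it has a complex root that is not radical. -/
theorem stmt18 :
    Irreducible ((X : ℚ[X]) ^ 5 - 6 * X + 3) ∧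
    Nonempty ((((X : ℚ[X]) ^ 5 - 6 * X + 3).SplittingField ≃ₐ[ℚ]
        ((X : ℚ[X]) ^ 5 - 6 * X + 3).SplittingField) ≃* Equiv.Perm (Fin 5)) ∧
    ∃ z : ℂ, Polynomial.aeval z ((X : ℚ[X]) ^ 5 - 6 * X + 3) = 0 ∧ z ∉ Qrad := by
  obtain ⟨e⟩ := nonempty_gal_mulEquiv_perm
  refine ⟨irreducible_X_pow_five_sub, ⟨e⟩, ?_⟩
  obtain ⟨z, hz⟩ := IsAlgClosed.exists_aeval_eq_zero ℂ (X ^ 5 - 6 * X + 3 : ℚ[X])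
    irreducible_X_pow_five_sub.degree_pos.ne'
  refine ⟨z, hz, fun hrad => Equiv.Perm.not_isSolvable_fin_5 ?_⟩
  have := isSolvable_gal_of_irreducible (mem_solvableByRad_of_mem_Qrad hrad)
    irreducible_X_pow_five_sub hz
  exact Group.isSolvable_of_surjective (f := e.toMonoidHom) e.surjective
end
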